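/- Let R be a purely infinite simple ring. Then every nonzero finitely generated projective right R-module is directly infinite. Consequently, for any nonzero finitely generated projective right R-modules P and Q there exists a nonzero right R-module A such that P is isomorphic to Q ⊕ A. -/

import Mathlib

universe u v w

/-- Murray–von Neumann equivalence of idempotents: `e ∼ f` iff there are `x ∈ eRf`,
`y ∈ fRe` with `x*y = e` and `y*x = f`. -/
def IdemEquiv {R : Type*} [Ring R] (e f : R) : Prop :=
  ∃ x y : R, x = e * x * f ∧ y = f * y * e ∧ x * y = e ∧ y * x = f

/-- An idempotent `e` is infinite if `e = f + g` for orthogonal idempotents `f, g`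
with `g ≠ 0` and `e ∼ f`. -/
def IsInfiniteIdem {R : Type*} [Ring R] (e : R) : Prop :=
  IsIdempotentElem e ∧ ∃ f g : R, IsIdempotentElem f ∧ IsIdempotentElem g ∧
    f * g = 0 ∧ g * f = 0 ∧ e = f + g ∧ g ≠ 0 ∧ IdemEquiv e f

/-- A ring is purely infinite simple if it is simple and every nonzero right ideal
(submodule of `R` as a right module over itself, i.e. as an `Rᵐᵒᵖ`-module)
contains an infinite idempotent. -/
def PurelyInfiniteSimple (R : Type*) [Ring R] : Prop :=
  IsSimpleRing R ∧ ∀ I : Submodule Rᵐᵒᵖ R, I ≠ ⊥ → ∃ e ∈ I, IsInfiniteIdem e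

/-- A module `M` is directly infinite if `M ≅ M ⊕ B` for some nonzero module `B`. -/
def DirectlyInfinite (R : Type u) (M : Type v) [Ring R] [AddCommGroup M] [Module R M] : Prop :=
  ∃ (B : Type v) (_ : AddCommGroup B) (_ : Module R B),
    Nontrivial B ∧ Nonempty (M ≃ₗ[R] M × B)

theorem aux_sum {S : Type*} [Ring S] [IsSimpleRing S] {g : S} (hg : g ≠ 0) :
    ∃ (n : ℕ) (c d : Fin n → S), ∑ i, c i * g * d i = 1 := by
  have h1 : (1 : S) ∈ TwoSidedIdeal.span ({g} : Set S) :=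
    IsSimpleRing.one_mem_of_ne_zero_mem _ hg (TwoSidedIdeal.subset_span (by simp))
  rw [TwoSidedIdeal.mem_span_iff_mem_addSubgroup_closure] at h1
  generalize (1 : S) = w at h1 ⊢
  induction h1 using AddSubgroup.closure_induction with
  | mem x hx =>
    obtain ⟨_, ⟨a, -, _, rfl, rfl⟩, b, -, rfl⟩ := hx
    exact ⟨1, fun _ => a, fun _ => b, by simp⟩
  | zero => exact ⟨0, fun _ => 0, fun _ => 0, by simp⟩
  | add x y _ _ hx hy =>
    obtain ⟨n, c, d, rfl⟩ := hx
    obtain ⟨m, c', d', rfl⟩ := hy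
    exact ⟨n + m, Fin.append c c', Fin.append d d', by simp [Fin.sum_univ_add]⟩
  | neg x _ hx =>
    obtain ⟨n, c, d, rfl⟩ := hx
    exact ⟨n, fun i => - c i, d, by simp⟩

theorem aux_orth {S : Type*} [Ring S] {e g x y : S} (hg : g * g = g) (heg : e * g = g)
    (hge : g * e = g) (hxy : x * y = e) (hgy : g * y = 0) (hxg : x * g = 0)
    (hxe : x * e = x) (hey : e * y = y) (i j : ℕ) :
    (g * x ^ i) * e * (y ^ j * g) = if i = j then g else 0 := by
  have A : ∀ k, g * x ^ k * e = g * x ^ k := by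
    intro k
    cases k with
    | zero => simpa using hge
    | succ k => rw [pow_succ, mul_assoc, mul_assoc, hxe]
  have B : ∀ k, e * (y ^ k * g) = y ^ k * g := by
    intro k
    cases k with
    | zero => simpa using heg
    | succ k => rw [pow_succ', ← mul_assoc, ← mul_assoc, hey]
  have step : ∀ a b, (g * x ^ (a+1)) * e * (y ^ (b+1) * g) = (g * x ^ a) * e * (y ^ b * g) := by
    intro a b
    rw [A, A, pow_succ, pow_succ', show g * (x ^ a * x) * (y * y ^ b * g)
      = g * x ^ a * ((x * y) * (y ^ b * g)) by noncomm_ring, hxy, B]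
  induction i generalizing j with
  | zero =>
    cases j with
    | zero => simp [hge, hg]
    | succ j =>
      rw [A, pow_succ', pow_zero, mul_one, ← mul_assoc, ← mul_assoc, hgy]
      simp
  | succ i ih =>
    cases j with
    | zero =>
      rw [A, pow_succ, pow_zero, one_mul, mul_assoc, mul_assoc, hxg]
      simp
    | succ j => rw [step, ih]; simp

theorem aux_fam {S : Type*} [Ring S] [IsSimpleRing S] {e g x y : S} (hg0 : g ≠ 0)
    (hg : g * g = g) (heg : e * g = g)
    (hge : g * e = g) (hxy : x * y = e) (hgy : g * y = 0) (hxg : x * g = 0)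
    (hxe : x * e = x) (hey : e * y = y) (m : ℕ) :
    ∃ a b : Fin m → S, ∀ i j, a i * e * b j = if i = j then 1 else 0 := by
  obtain ⟨n, c, d, hcd⟩ := aux_sum hg0
  let K : Fin m → Fin n → ℕ := fun l i => (finProdFinEquiv (l, i)).val
  have hK : ∀ l i l' i', K l i = K l' i' ↔ l = l' ∧ i = i' := by
    intro l i l' i'
    simp only [K, Fin.val_inj, EmbeddingLike.apply_eq_iff_eq, Prod.mk.injEq]
  refine ⟨fun l => ∑ i, c i * (g * x ^ K l i), fun l => ∑ i, (y ^ K l i * g) * d i, ?_⟩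
  intro l l'
  have : ∀ i i', c i * (g * x ^ K l i) * e * ((y ^ K l' i' * g) * d i')
      = if l = l' ∧ i = i' then c i * g * d i' else 0 := by
    intro i i'
    have := aux_orth hg heg hge hxy hgy hxg hxe hey (K l i) (K l' i')
    rw [show c i * (g * x ^ K l i) * e * ((y ^ K l' i' * g) * d i')
      = c i * ((g * x ^ K l i) * e * (y ^ K l' i' * g)) * d i' by noncomm_ring, this]
    simp only [hK]
    split_ifs <;> simp
  simp only [Finset.sum_mul, Finset.mul_sum, this]
  by_cases hl : l = l'
  · simp [hl, hcd]
  · simp [hl]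

def LeftPI (S : Type*) [Ring S] : Prop :=
  ∀ I : Submodule S S, I ≠ ⊥ → ∃ e ∈ I, ∃ g x y : S, g ≠ 0 ∧ g * g = g ∧ e * g = g ∧
    g * e = g ∧ x * y = e ∧ g * y = 0 ∧ x * g = 0 ∧ x * e = x ∧ e * y = y

theorem aux_leftPI {R : Type*} [Ring R] (h : PurelyInfiniteSimple R) : LeftPI Rᵐᵒᵖ := by
  intro I hI
  have hI' : I.comap (MulOpposite.opLinearEquiv Rᵐᵒᵖ : R ≃ₗ[Rᵐᵒᵖ] Rᵐᵒᵖ).toLinearMap ≠ ⊥ := by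
    obtain ⟨z, hz, hz0⟩ := Submodule.exists_mem_ne_zero_of_ne_bot hI
    rw [Submodule.ne_bot_iff]
    exact ⟨z.unop, by simpa using hz, by simpa using hz0⟩
  obtain ⟨e, heI, he, f, g, hf, hg, hfg, hgf, hefg, hg0, x, y, hx, hy, hxy, hyx⟩ := h.2 _ hI'
  unfold IsIdempotentElem at he hf hg
  have hfe : f * e = f := by rw [hefg, mul_add, hf, hfg, add_zero]
  have hef : e * f = f := by rw [hefg, add_mul, hf, hgf, add_zero]
  have hge : g * e = g := by rw [hefg, mul_add, hg, hgf, zero_add]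
  have heg : e * g = g := by rw [hefg, add_mul, hg, hfg, zero_add]
  have hxe : x * e = x := by rw [hx, mul_assoc, hfe]
  have hey : e * y = y := by rw [hy, ← mul_assoc, ← mul_assoc, hef]
  have hxg : x * g = 0 := by rw [hx, mul_assoc, hfg, mul_zero]
  have hgy : g * y = 0 := by rw [hy, ← mul_assoc, ← mul_assoc, hgf, zero_mul, zero_mul]
  refine ⟨.op e, by simpa using heI, .op g, .op y, .op x, ?_⟩
  simp only [← MulOpposite.op_mul, ← MulOpposite.op_zero, MulOpposite.op_inj, ne_eq]
  exact ⟨hg0, hg, hge, heg, hxy, hxg, hgy, hey, hxe⟩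

theorem aux_embed {S : Type*} [Ring S] [IsSimpleRing S] (h : LeftPI S) (P : Type*)
    [AddCommGroup P] [Module S P] [Module.Projective S P] [Nontrivial P] (m : ℕ) :
    ∃ (i : (Fin m → S) →ₗ[S] P) (r : P →ₗ[S] (Fin m → S)), ∀ z, r (i z) = z := by
  obtain ⟨p₀, hp₀⟩ := exists_ne (0 : P)
  obtain ⟨φ, hφ⟩ : ∃ φ : P →ₗ[S] S, φ p₀ ≠ 0 := by
    obtain ⟨s, hs⟩ : ∃ s : P →ₗ[S] P →₀ S, Function.LeftInverse (Finsupp.linearCombination S id) s :=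
      Module.projective_def.mp (‹Module.Projective S P›)
    by_contra! hcon
    have : s p₀ = 0 := by
      ext q
      simpa using hcon (Finsupp.lapply q ∘ₗ s)
    have h2 := hs p₀
    rw [this, map_zero] at h2
    exact hp₀ h2.symm
  obtain ⟨e, ⟨p, hp⟩, g, x, y, hg0, hg, heg, hge, hxy, hgy, hxg, hxe, hey⟩ :=
    h (LinearMap.range φ) (by
      rw [Submodule.ne_bot_iff]; exact ⟨φ p₀, ⟨p₀, rfl⟩, hφ⟩)
  obtain ⟨a, b, hab⟩ := aux_fam hg0 hg heg hge hxy hgy hxg hxe hey m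
  refine ⟨∑ l, (LinearMap.toSpanSingleton S P (a l • p)) ∘ₗ LinearMap.proj l,
    LinearMap.pi fun l => LinearMap.toSpanSingleton S S (b l) ∘ₗ φ, ?_⟩
  intro z
  ext l
  simp [hp]
  simp [← mul_assoc (a _), hab]

theorem aux_main {S : Type u} [Ring S] [IsSimpleRing S] (h : LeftPI S) (P Q : Type v)
    [AddCommGroup P] [Module S P] [AddCommGroup Q] [Module S Q]
    [Module.Projective S P] [Nontrivial P] [Module.Finite S Q] [Module.Projective S Q] :
    ∃ (A : Type v) (_ : AddCommGroup A) (_ : Module S A),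
          Nontrivial A ∧ Nonempty (P ≃ₗ[S] Q × A) := by
  obtain ⟨n, f, k, -, -, hfk⟩ := Module.Finite.exists_comp_eq_id_of_projective S Q
  obtain ⟨i, r, hir⟩ := aux_embed h P (n + 1)
  let T : (Fin (n+1) → S) →ₗ[S] (Fin n → S) := LinearMap.pi fun l => LinearMap.proj l.succ
  let C : (Fin n → S) →ₗ[S] (Fin (n+1) → S) :=
    LinearMap.pi (Fin.cons 0 fun l => LinearMap.proj l)
  have hTC : ∀ z, T (C z) = z := by intro z; ext l; simp [T, C]
  let I : Q →ₗ[S] P := i ∘ₗ C ∘ₗ k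
  let r' : P →ₗ[S] Q := f ∘ₗ T ∘ₗ r
  have hI : ∀ q, r' (I q) = q := by
    intro q
    simp only [r', I, LinearMap.comp_apply, hir, hTC]
    exact LinearMap.congr_fun hfk q
  refine ⟨LinearMap.ker r', inferInstance, inferInstance, ?_, ⟨?_⟩⟩
  · let z : Fin (n+1) → S := Pi.single 0 1
    have hTz : T z = 0 := by ext l; simp [T, z]
    have hz : z ≠ 0 := by intro hz; simpa [z] using congrFun hz 0
    refine ⟨⟨i z, ?_⟩, 0, ?_⟩
    · simp [r', hir, hTz]
    · intro h0
      have h1 : i z = 0 := congrArg Subtype.val h0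
      apply hz
      rw [← hir z, h1, map_zero]
  · have hc : ∀ c : P, ((LinearMap.id - I ∘ₗ r' : P →ₗ[S] P)) c ∈ LinearMap.ker r' := by intro c; simp [hI]
    exact LinearEquiv.ofLinearMap
      (r'.prod ((LinearMap.id - I ∘ₗ r').codRestrict _ hc))
      (I.coprod (LinearMap.ker r').subtype)
      (by
        apply LinearMap.ext
        rintro ⟨q, a, ha⟩
        rw [LinearMap.mem_ker] at ha
        ext <;> simp [hI, ha])
      (by
        apply LinearMap.ext
        intro p
        simp)

/-- In a purely infinite simple ring every nonzero finitely generated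
projective right module is directly infinite; consequently for any two such modules
`P`, `Q` there is a nonzero module `A` with `P ≅ Q ⊕ A`. -/
theorem stmt1 {R : Type u} [Ring R] (h : PurelyInfiniteSimple R) :
    (∀ (P : Type v) [AddCommGroup P] [Module Rᵐᵒᵖ P],
      Module.Finite Rᵐᵒᵖ P → Module.Projective Rᵐᵒᵖ P → Nontrivial P →
        DirectlyInfinite Rᵐᵒᵖ P) ∧
    (∀ (P Q : Type v) [AddCommGroup P] [Module Rᵐᵒᵖ P] [AddCommGroup Q] [Module Rᵐᵒᵖ Q],
      Module.Finite Rᵐᵒᵖ P → Module.Projective Rᵐᵒᵖ P → Nontrivial P →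
      Module.Finite Rᵐᵒᵖ Q → Module.Projective Rᵐᵒᵖ Q → Nontrivial Q →
        ∃ (A : Type v) (_ : AddCommGroup A) (_ : Module Rᵐᵒᵖ A),
          Nontrivial A ∧ Nonempty (P ≃ₗ[Rᵐᵒᵖ] Q × A)) := by
  have := h.1
  have hS := aux_leftPI h
  exact ⟨fun P _ _ _ _ _ => aux_main hS P P, fun P Q _ _ _ _ _ _ _ _ _ _ => aux_main hS P Q⟩
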